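/- arXiv:2304.02402 — 2 statements merged into one kernel-verified Lean document; each statement's English description precedes it below -/
import Mathlib

section
/- Let ν and ν₁, ν₂, … be absolutely continuous probability measures on S¹ such that W₂(ν_n, ν) → 0 (Wasserstein distance with respect to the arc-length distance d_R on S¹). Then W₂(log_c # ν_n, log_c # ν) → 0, where the latter is the 2-Wasserstein distance between the pushforward measures on ℝ (supported in [0,2π)) with respect to the Euclidean distance on ℝ. -/
open MeasureTheory Real Set Filter Topology

noncomputable section

instance : Fact (0 < 2 * Real.pi) := ⟨by positivity⟩

/-- The circle `ℝ / 2πℤ`. -/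
abbrev S1 : Type := AddCircle (2 * Real.pi)

/-- The quotient projection `exp_c : ℝ → S¹`. -/
def expc (x : ℝ) : S1 := (x : S1)

/-- The canonical right inverse `log_c : S¹ → [0, 2π)`. -/
def logc (z : S1) : ℝ := (AddCircle.equivIco (2 * Real.pi) 0 z : ℝ)

/-- Squared 2-Wasserstein distance: infimum of `∫ d(x,y)² dγ` over couplings `γ`. -/
def W2sq {X : Type*} [MeasurableSpace X] [PseudoMetricSpace X]
    (μ ν : Measure X) : ℝ :=
  sInf { c : ℝ | ∃ γ : Measure (X × X), IsProbabilityMeasure γ ∧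
      γ.map Prod.fst = μ ∧ γ.map Prod.snd = ν ∧
      c = ∫ p, dist p.1 p.2 ^ 2 ∂γ }

/-- `T` is an optimal transport map from `μ` to `ν`. -/
def IsOTM (μ ν : Measure S1) (T : S1 → S1) : Prop :=
  Measurable T ∧ μ.map T = ν ∧ (∫ z, dist z (T z) ^ 2 ∂μ) = W2sq μ ν

/-- `μ̃`, the pushforward of a measure on `S¹` to `[0, 2π) ⊆ ℝ` via `log_c`. -/
def tilde (μ : Measure S1) : Measure ℝ := μ.map logc

/-- The periodic cumulative distribution function of a (periodicised) measure on `[0,2π)`: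
`F(x) = μ̃([0,x))` for `x ∈ [0,2π]`, extended by `F(x + 2π) = F(x) + 1`. -/
def cdf (μt : Measure ℝ) (x : ℝ) : ℝ :=
  ⌊x / (2 * π)⌋ + (μt (Set.Ico 0 (Int.fract (x / (2 * π)) * (2 * π)))).toReal

/-- The quantile function (generalized inverse) of the periodic cdf. -/
def qf (μt : Measure ℝ) (u : ℝ) : ℝ := sInf { x : ℝ | u ≤ cdf μt x }

/-- The cost `C_{[μ,ν]}(θ) = ∫₀¹ (F_μ̃⁻(u) − F_ν̃⁻(u−θ))² du`. -/
def cost (μ ν : Measure S1) (θ : ℝ) : ℝ :=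
  ∫ u in (0:ℝ)..1, (qf (tilde μ) u - qf (tilde ν) (u - θ)) ^ 2


/-- Reading off the angle in `[0, 2π)` preserves the distance between two points of the circle,
unless the shorter arc between them passes through the base point. -/
lemma abs_logc_sub_eq_or (x y : S1) :
    |logc x - logc y| = dist x y ∨ dist y 0 ≤ dist x y := by
  obtain ⟨ha0, ha1⟩ := (AddCircle.equivIco (2 * π) 0 x).2
  obtain ⟨hb0, hb1⟩ := (AddCircle.equivIco (2 * π) 0 y).2
  have hx : ((logc x : ℝ) : S1) = x := AddCircle.coe_equivIco
  have hy : ((logc y : ℝ) : S1) = y := AddCircle.coe_equivIco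
  change 0 ≤ logc x at ha0
  change logc x < 0 + 2 * π at ha1
  change 0 ≤ logc y at hb0
  change logc y < 0 + 2 * π at hb1
  generalize logc x = a at *
  generalize logc y = b at *
  subst hx hy
  have hp : (2 * π) ≠ 0 := by positivity
  have hpi : |2 * π| / 2 = π := by rw [abs_of_pos (by positivity)]; ring
  have norm_eq (t : ℝ) (ht : |t| ≤ π) : ‖(t : S1)‖ = |t| :=
    (AddCircle.norm_coe_eq_abs_iff _ hp).2 (by rwa [hpi])
  have norm_le (t : ℝ) : ‖(t : S1)‖ ≤ |t| := QuotientAddGroup.norm_mk_le_norm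
  rw [dist_eq_norm, dist_zero_right, ← AddCircle.coe_sub]
  rcases le_or_gt |a - b| π with h | h
  · exact Or.inl (norm_eq _ h).symm
  right
  rcases le_total b a with hab | hab
  · rw [abs_of_nonneg (by linarith)] at h
    have h1 : ((a - b : ℝ) : S1) = ((a - b - 2 * π : ℝ) : S1) := by
      rw [← AddCircle.coe_add_period (2 * π) (a - b - 2 * π), sub_add_cancel]
    have h2 : |a - b - 2 * π| = 2 * π - (a - b) := by
      rw [abs_of_nonpos (by linarith)]; ring
    rw [h1, norm_eq (a - b - 2 * π) (by rw [h2]; linarith), h2]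
    refine (norm_le b).trans ?_
    rw [abs_of_nonneg hb0]; linarith
  · rw [abs_of_nonpos (by linarith)] at h
    have h1 : ((a - b : ℝ) : S1) = ((a - b + 2 * π : ℝ) : S1) := by
      rw [AddCircle.coe_add_period]
    have h2 : |a - b + 2 * π| = a - b + 2 * π := abs_of_nonneg (by linarith)
    have h3 : (b : S1) = ((b - 2 * π : ℝ) : S1) := by
      rw [AddCircle.coe_sub, AddCircle.coe_period, sub_zero]
    rw [h1, norm_eq (a - b + 2 * π) (by rw [h2]; linarith), h2, h3]
    refine (norm_le _).trans ?_
    rw [abs_of_nonpos (by linarith)]; linarith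

lemma abs_logc_sub_le (x y : S1) : |logc x - logc y| ≤ 2 * π := by
  obtain ⟨ha0, ha1⟩ := (AddCircle.equivIco (2 * π) 0 x).2
  obtain ⟨hb0, hb1⟩ := (AddCircle.equivIco (2 * π) 0 y).2
  unfold logc
  rw [abs_le]
  constructor <;> linarith

lemma measurable_logc : Measurable logc :=
  measurable_subtype_coe.comp (AddCircle.measurableEquivIco (2 * π) 0).measurable

lemma sq_dist_logc_le {δ : ℝ} (hδ : 0 < δ) (x y : S1) :
    dist (logc x) (logc y) ^ 2 ≤ (1 + (2 * π) ^ 2 / δ ^ 2) * dist x y ^ 2 +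
      (Metric.ball (0 : S1) δ).indicator (fun _ => (2 * π) ^ 2) y := by
  rw [Real.dist_eq]
  have hind : 0 ≤ (Metric.ball (0 : S1) δ).indicator (fun _ => (2 * π) ^ 2) y :=
    indicator_nonneg (fun _ _ => by positivity) _
  have hK : 0 ≤ (2 * π) ^ 2 / δ ^ 2 * dist x y ^ 2 := by positivity
  have hsq : |logc x - logc y| ^ 2 ≤ (2 * π) ^ 2 :=
    pow_le_pow_left₀ (abs_nonneg _) (abs_logc_sub_le x y) 2
  rcases abs_logc_sub_eq_or x y with h | h
  · rw [h]; linarith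
  by_cases hy : y ∈ Metric.ball (0 : S1) δ
  · rw [indicator_of_mem hy]
    linarith [sq_nonneg (dist x y)]
  · have hd : δ ≤ dist x y := (not_lt.1 hy).trans h
    have : (2 * π) ^ 2 ≤ (2 * π) ^ 2 / δ ^ 2 * dist x y ^ 2 := by
      rw [div_mul_eq_mul_div, le_div_iff₀ (by positivity)]
      gcongr
    linarith [sq_nonneg (dist x y)]

lemma W2sq_nonneg {X : Type*} [MeasurableSpace X] [PseudoMetricSpace X] (μ ν : Measure X) :
    0 ≤ W2sq μ ν := by
  refine Real.sInf_nonneg ?_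
  rintro c ⟨γ, -, -, -, rfl⟩
  positivity

lemma W2sq_le_integral {X : Type*} [MeasurableSpace X] [PseudoMetricSpace X]
    (γ : Measure (X × X)) [IsProbabilityMeasure γ] :
    W2sq (γ.map Prod.fst) (γ.map Prod.snd) ≤ ∫ p, dist p.1 p.2 ^ 2 ∂γ := by
  refine csInf_le ⟨0, ?_⟩ ⟨γ, inferInstance, rfl, rfl, rfl⟩
  rintro c ⟨γ', -, -, -, rfl⟩
  positivity

lemma W2sq_tilde_le (μ ν : Measure S1) [IsProbabilityMeasure μ] [IsProbabilityMeasure ν]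
    {δ : ℝ} (hδ : 0 < δ) :
    W2sq (tilde μ) (tilde ν) ≤ (1 + (2 * π) ^ 2 / δ ^ 2) * W2sq μ ν +
      (2 * π) ^ 2 * ν.real (Metric.ball 0 δ) := by
  have hK : 0 < 1 + (2 * π) ^ 2 / δ ^ 2 := by positivity
  rw [← sub_le_iff_le_add, ← div_le_iff₀' hK]
  refine le_csInf ⟨_, μ.prod ν, inferInstance, by simp, by simp, rfl⟩ ?_
  rintro c ⟨γ, hγ, rfl, rfl, rfl⟩
  rw [div_le_iff₀' hK, sub_le_iff_le_add]
  have hm : Measurable (Prod.map logc logc) := measurable_logc.prodMap measurable_logc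
  have : IsProbabilityMeasure (γ.map (Prod.map logc logc)) :=
    Measure.isProbabilityMeasure_map hm.aemeasurable
  have hle := W2sq_le_integral (γ.map (Prod.map logc logc))
  have h1 : (γ.map (Prod.map logc logc)).map Prod.fst = tilde (γ.map Prod.fst) := by
    rw [tilde, Measure.map_map measurable_fst hm, Measure.map_map measurable_logc measurable_fst]
    rfl
  have h2 : (γ.map (Prod.map logc logc)).map Prod.snd = tilde (γ.map Prod.snd) := by
    rw [tilde, Measure.map_map measurable_snd hm, Measure.map_map measurable_logc measurable_snd]
    rfl
  rw [h1, h2, integral_map hm.aemeasurable (by fun_prop)] at hle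
  have hball : MeasurableSet (Prod.snd ⁻¹' Metric.ball (0 : S1) δ : Set (S1 × S1)) :=
    measurable_snd Metric.isOpen_ball.measurableSet
  have hi1 : Integrable (fun p : S1 × S1 => (1 + (2 * π) ^ 2 / δ ^ 2) * dist p.1 p.2 ^ 2) γ := by
    refine Continuous.integrable_of_hasCompactSupport (by fun_prop) ?_
    exact HasCompactSupport.of_compactSpace _
  have hi2 : Integrable
      ((Prod.snd ⁻¹' Metric.ball (0 : S1) δ).indicator fun _ : S1 × S1 => (2 * π) ^ 2) γ :=
    (integrable_const _).indicator hball
  refine hle.trans ((integral_mono_of_nonneg (.of_forall fun p => by positivity) (hi1.add hi2)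
    (.of_forall fun p => sq_dist_logc_le hδ p.1 p.2)).trans_eq ?_)
  rw [integral_add' hi1 hi2, integral_const_mul, integral_indicator_const _ hball,
    map_measureReal_apply measurable_snd Metric.isOpen_ball.measurableSet, smul_eq_mul,
    mul_comm ((2 * π) ^ 2)]

lemma tendsto_measureReal_ball {X : Type*} [MetricSpace X] [MeasurableSpace X]
    [OpensMeasurableSpace X] (μ : Measure X) [IsFiniteMeasure μ] (x : X) :
    Tendsto (fun δ => μ.real (Metric.ball x δ)) (𝓝[>] 0) (𝓝 (μ.real {x})) := by
  have h := tendsto_measure_thickening_of_isClosed (μ := μ) (s := {x})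
    ⟨1, one_pos, measure_ne_top _ _⟩ isClosed_singleton
  simp_rw [Metric.thickening_singleton] at h
  exact (ENNReal.tendsto_toReal (measure_ne_top _ _)).comp h

/-- If a.c. measures on `S¹` satisfy `W₂(ν_n, ν) → 0` for the arc-length
distance, then their pushforwards to `[0, 2π) ⊂ ℝ` by `log_c` satisfy
`W₂(log_c # ν_n, log_c # ν) → 0` for the Euclidean distance on `ℝ`. -/
theorem stmt9 (ν : Measure S1) [IsProbabilityMeasure ν] (hacν : ν ≪ volume)
    (νs : ℕ → Measure S1) [∀ n, IsProbabilityMeasure (νs n)]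
    (hacνs : ∀ n, νs n ≪ volume)
    (hconv : Tendsto (fun n => Real.sqrt (W2sq (νs n) ν)) atTop (𝓝 0)) :
    Tendsto (fun n => Real.sqrt (W2sq (tilde (νs n)) (tilde ν))) atTop (𝓝 0) := by
  have h0 : Tendsto (fun n => W2sq (νs n) ν) atTop (𝓝 0) := by
    simpa [Real.sq_sqrt (W2sq_nonneg _ _)] using hconv.pow 2
  have hatom : ν.real {0} = 0 := by
    have hvol : (volume : Measure S1) {0} = 0 := by
      simpa using AddCircle.volume_closedBall (2 * π) (x := 0) 0
    simp [Measure.real, hacν hvol]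
  suffices Tendsto (fun n => W2sq (tilde (νs n)) (tilde ν)) atTop (𝓝 0) by
    simpa using this.sqrt
  refine tendsto_order.2 ⟨fun a ha => .of_forall fun n => ha.trans_le (W2sq_nonneg _ _),
    fun ε hε => ?_⟩
  have hball := (tendsto_measureReal_ball ν 0).const_mul ((2 * π) ^ 2)
  rw [hatom, mul_zero] at hball
  obtain ⟨δ, hδε, hδ⟩ := ((hball.eventually_lt_const (half_pos hε)).and
    self_mem_nhdsWithin).exists
  have hlim := h0.const_mul (1 + (2 * π) ^ 2 / δ ^ 2)
  rw [mul_zero] at hlim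
  filter_upwards [hlim.eventually_lt_const (half_pos hε)] with n hn
  linarith [W2sq_tilde_le (νs n) ν hδ]

end
end

section
/- Let μ, ν, ν₁, ν₂, … be absolutely continuous probability measures on S¹. Let T be the optimal transport map from μ to ν and T_n the optimal transport map from μ to ν_n, with lifts G, G_n : S¹ → ℝ defined by G(z) := the representative in [−π, π) of the displacement of T at z (so that T(z) = exp_c(log_c z + G(z))), and similarly for G_n. If ∫_{S¹} d_R(T_n(z), T(z))² dμ(z) → 0 as n → ∞, then ∫_{S¹} (G_n(z) − G(z))² dμ(z) → 0. -/
open MeasureTheory Real Set Filter Topology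

noncomputable section

lemma volume_singleton_circle (x : S1) : (volume : Measure S1) {x} = 0 := by
  have h := AddCircle.volume_closedBall (T := 2 * Real.pi) (x := x) 0
  rw [Metric.closedBall_zero] at h
  rw [h]
  simp [Real.pi_pos.le]

lemma circle_norm_le_pi (x : S1) : ‖x‖ ≤ π := by
  have h := AddCircle.norm_le_half_period (p := 2 * Real.pi) (x := x) (by positivity)
  rwa [abs_of_pos (by positivity), mul_div_cancel_left₀ _ two_ne_zero] at h

lemma circle_norm_le_abs_add (t : ℝ) (k : ℤ) : ‖(t : S1)‖ ≤ |t + k * (2 * π)| := by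
  have h : ((t + k * (2 * π) : ℝ) : S1) = (t : S1) := by
    rw [← zsmul_eq_mul]; simp
  rw [← h]
  exact QuotientAddGroup.norm_mk_le_norm

lemma exists_circle_norm_eq (t : ℝ) : ∃ k : ℤ, ‖(t : S1)‖ = |t + k * (2 * π)| :=
  ⟨-round ((2 * π)⁻¹ * t), by rw [AddCircle.norm_eq]; push_cast; ring_nf⟩

lemma circle_coe_pi_eq_neg : ((-π : ℝ) : S1) = (π : S1) := by
  have h := AddCircle.coe_add_period (2 * π) (-π)
  rw [← h]
  congr 1
  ring

lemma circle_norm_eq_pi {x : S1} (hx : ‖x‖ = π) : x = ((π : ℝ) : S1) := by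
  induction x using QuotientAddGroup.induction_on with
  | H t =>
    obtain ⟨k, hk⟩ := exists_circle_norm_eq t
    have h : ((t + k * (2 * π) : ℝ) : S1) = (t : S1) := by
      rw [← zsmul_eq_mul]; simp
    change ‖(t : S1)‖ = π at hx
    change (t : S1) = _
    rw [hx] at hk
    rw [← h]
    rcases eq_or_eq_neg_of_abs_eq hk.symm with h' | h'
    · rw [h']
    · rw [h', circle_coe_pi_eq_neg]

lemma circle_dist_le_pi (x y : S1) : dist x y ≤ π := by
  rw [dist_eq_norm]; exact circle_norm_le_pi _

lemma circle_dist_eq_pi_iff {x y : S1} : dist x y = π ↔ y = x + (π : ℝ) := by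
  rw [dist_comm, dist_eq_norm]
  constructor
  · intro h
    rw [← circle_norm_eq_pi h]; abel
  · rintro rfl
    have h := AddCircle.norm_half_period_eq (p := 2 * π)
    rw [abs_of_pos (by positivity), mul_div_cancel_left₀ _ two_ne_zero] at h
    simpa using h

lemma integrable_circle_dist_sq {α : Type*} [MeasurableSpace α] (μ : Measure α)
    [IsFiniteMeasure μ] {f g : α → S1} (hf : Measurable f) (hg : Measurable g) :
    Integrable (fun a => dist (f a) (g a) ^ 2) μ := by
  refine Integrable.of_bound ((hf.dist hg).pow_const 2).aestronglyMeasurable (π ^ 2)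
    (Eventually.of_forall fun a => ?_)
  rw [Real.norm_of_nonneg (by positivity)]
  gcongr
  exact circle_dist_le_pi _ _

/-- An optimal transport map to an atomless measure moves almost no point to its antipode: the
part of the mass sent to antipodes would be transported more cheaply by a product coupling. -/
lemma IsOTM.measure_antipodal_eq_zero {μ ν : Measure S1} [IsProbabilityMeasure μ]
    (hν : ∀ x, ν {x} = 0) {T : S1 → S1} (hT : IsOTM μ ν T) :
    μ {z | T z = z + (π : ℝ)} = 0 := by
  obtain ⟨hTm, hTν, hopt⟩ := hT
  set A : Set S1 := {z | T z = z + (π : ℝ)} with hA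
  have hAm : MeasurableSet A := measurableSet_eq_fun hTm (measurable_id.add_const _)
  by_contra hA0
  have hAtop : μ A ≠ ⊤ := measure_ne_top μ A
  set ρ := μ.restrict A with hρ
  set σ := ρ.map T with hσ
  have hρu : ρ univ = μ A := by simp [hρ]
  have hσu : σ univ = μ A := by rw [hσ, Measure.map_apply hTm .univ, preimage_univ, hρu]
  have hσν : σ ≤ ν := by
    rw [hσ, ← hTν]
    exact Measure.map_mono Measure.restrict_le_self hTm
  have hpair : Measurable fun z => (z, T z) := measurable_id.prodMk hTm
  set γ₁ := (μ.restrict Aᶜ).map fun z => (z, T z) with hγ₁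
  set γ := γ₁ + (μ A)⁻¹ • ρ.prod σ with hγ
  have hfst : γ.map Prod.fst = μ := by
    rw [hγ, Measure.map_add _ _ measurable_fst, Measure.map_smul, Measure.map_fst_prod, hσu,
      smul_smul, ENNReal.inv_mul_cancel hA0 hAtop, one_smul, hγ₁,
      Measure.map_map measurable_fst hpair]
    change (μ.restrict Aᶜ).map id + ρ = μ
    rw [Measure.map_id, add_comm, hρ, Measure.restrict_add_restrict_compl hAm]
  have hsnd : γ.map Prod.snd = ν := by
    rw [hγ, Measure.map_add _ _ measurable_snd, Measure.map_smul, Measure.map_snd_prod, hρu,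
      smul_smul, ENNReal.inv_mul_cancel hA0 hAtop, one_smul, hγ₁,
      Measure.map_map measurable_snd hpair]
    change (μ.restrict Aᶜ).map T + ρ.map T = ν
    rw [← Measure.map_add _ _ hTm, add_comm, hρ, Measure.restrict_add_restrict_compl hAm, hTν]
  have hγp : IsProbabilityMeasure γ := by
    constructor
    rw [← preimage_univ (f := Prod.fst), ← Measure.map_apply measurable_fst .univ, hfst,
      measure_univ]
  have hE : Measurable fun p : S1 × S1 => dist p.1 p.2 ^ 2 :=
    (measurable_fst.dist measurable_snd).pow_const 2
  have hEI (κ : Measure (S1 × S1)) [IsFiniteMeasure κ] :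
      Integrable (fun p : S1 × S1 => dist p.1 p.2 ^ 2) κ :=
    integrable_circle_dist_sq κ measurable_fst measurable_snd
  have hle : W2sq μ ν ≤ ∫ p, dist p.1 p.2 ^ 2 ∂γ := by
    refine csInf_le ⟨0, ?_⟩ ⟨γ, hγp, hfst, hsnd, rfl⟩
    rintro c ⟨κ, -, -, -, rfl⟩
    exact integral_nonneg fun p => sq_nonneg _
  have hcost : ∫ p, dist p.1 p.2 ^ 2 ∂γ = ∫ z in Aᶜ, dist z (T z) ^ 2 ∂μ
      + (μ.real A)⁻¹ * ∫ p, dist p.1 p.2 ^ 2 ∂(ρ.prod σ) := by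
    rw [hγ, integral_add_measure (hEI _)
      ((hEI (ρ.prod σ)).smul_measure (ENNReal.inv_ne_top.2 hA0)), integral_smul_measure, hγ₁,
      integral_map hpair.aemeasurable hE.aestronglyMeasurable, ENNReal.toReal_inv, smul_eq_mul,
      Measure.real]
  have hsplit : ∫ z, dist z (T z) ^ 2 ∂μ
      = μ.real A * π ^ 2 + ∫ z in Aᶜ, dist z (T z) ^ 2 ∂μ := by
    rw [← integral_add_compl hAm (f := fun z => dist z (T z) ^ 2)
      (integrable_circle_dist_sq μ measurable_id hTm)]
    congr 1
    rw [setIntegral_congr_fun (g := fun _ => π ^ 2) hAm fun z hz => by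
      simp only; rw [circle_dist_eq_pi_iff.2 hz]]
    simp
  have hm : 0 < μ.real A := ENNReal.toReal_pos hA0 hAtop
  have hI : μ.real A * (μ.real A * π ^ 2) ≤ ∫ p, dist p.1 p.2 ^ 2 ∂(ρ.prod σ) := by
    have h : μ.real A * π ^ 2 ≤ (μ.real A)⁻¹ * ∫ p, dist p.1 p.2 ^ 2 ∂(ρ.prod σ) := by
      linarith
    rwa [le_inv_mul_iff₀ hm] at h
  have hmass : (ρ.prod σ).real univ = μ.real A * μ.real A := by
    rw [Measure.real, ← univ_prod_univ, Measure.prod_prod, hρu, hσu, ENNReal.toReal_mul,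
      Measure.real]
  have hdefn : (0 : S1 × S1 → ℝ) ≤ fun p => π ^ 2 - dist p.1 p.2 ^ 2 := fun p => by
    have := circle_dist_le_pi p.1 p.2
    simp only [Pi.zero_apply, sub_nonneg]
    gcongr
  have hdefI := (integrable_const (μ := ρ.prod σ) (π ^ 2)).sub (hEI (ρ.prod σ))
  have hdef0 : ∫ p, (π ^ 2 - dist p.1 p.2 ^ 2) ∂(ρ.prod σ) = 0 := by
    refine le_antisymm ?_ (integral_nonneg hdefn)
    rw [integral_sub (integrable_const _) (hEI _), integral_const, hmass, smul_eq_mul]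
    linarith
  have hae := (integral_eq_zero_iff_of_nonneg hdefn hdefI).1 hdef0
  have hgraph : ∀ᵐ p ∂(ρ.prod σ), p.2 = p.1 + ((π : ℝ) : S1) := by
    filter_upwards [hae] with p hp
    refine circle_dist_eq_pi_iff.1 ?_
    simp only [Pi.zero_apply] at hp
    exact (sq_eq_sq₀ dist_nonneg pi_pos.le).1 (by linarith)
  have hgraph' : ∀ᵐ p ∂(ρ.prod σ), p.2 ≠ p.1 + ((π : ℝ) : S1) := by
    have hs : MeasurableSet {p : S1 × S1 | p.2 = p.1 + ((π : ℝ) : S1)} :=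
      measurableSet_eq_fun measurable_snd (measurable_fst.add_const _)
    rw [ae_iff]
    simp only [not_not]
    rw [Measure.prod_apply hs, lintegral_eq_zero_iff (measurable_measure_prodMk_left hs)]
    refine Eventually.of_forall fun z => ?_
    exact le_antisymm ((hσν _).trans (hν (z + ((π : ℝ) : S1))).le) zero_le
  have hfalse : ∀ᵐ p ∂(ρ.prod σ), False := by
    filter_upwards [hgraph, hgraph'] with p h h' using h' h
  rw [ae_iff] at hfalse
  simp only [not_false_eq_true, ofPred_true] at hfalse
  rw [Measure.real, hfalse] at hmass
  simp only [ENNReal.toReal_zero] at hmass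
  nlinarith

/-- Two displacements in `[-π, π)` differ exactly by the distance of the endpoints, unless the
endpoints are at least as far apart as one of them is from the antipode of the base point. -/
lemma abs_sub_eq_circle_norm_or_le {a b : ℝ} (ha : a ∈ Ico (-π) π) (hb : b ∈ Ico (-π) π) :
    |a - b| = ‖((a - b : ℝ) : S1)‖ ∨ ‖((π - b : ℝ) : S1)‖ ≤ ‖((a - b : ℝ) : S1)‖ := by
  obtain ⟨k, hk⟩ := exists_circle_norm_eq (a - b)
  obtain ⟨ha₁, ha₂⟩ := ha
  obtain ⟨hb₁, hb₂⟩ := hb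
  have h₀ := circle_norm_le_abs_add (π - b) 0
  have h₁ := circle_norm_le_abs_add (π - b) (-1)
  rw [abs_of_nonneg (by push_cast; linarith)] at h₀
  rw [abs_of_nonpos (by push_cast; linarith)] at h₁
  push_cast at h₀ h₁
  rcases lt_trichotomy k 0 with hk0 | rfl | hk0
  · right
    have : (k : ℝ) ≤ -1 := by exact_mod_cast Int.le_sub_one_of_lt hk0
    have := neg_le_abs (a - b + k * (2 * π))
    nlinarith [pi_pos]
  · left; simpa using hk.symm
  · right
    have : (1 : ℝ) ≤ k := by exact_mod_cast hk0
    have := le_abs_self (a - b + k * (2 * π))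
    nlinarith [pi_pos]

lemma coe_logc (z : S1) : ((logc z : ℝ) : S1) = z := AddCircle.coe_equivIco

lemma sq_displacement_sub_le {a b η : ℝ} {z x y : S1} (hη : 0 < η)
    (ha : a ∈ Ico (-π) π ∧ x = expc (logc z + a)) (hb : b ∈ Ico (-π) π ∧ y = expc (logc z + b)) :
    (a - b) ^ 2 ≤ (1 + 4 * π ^ 2 / η ^ 2) * dist x y ^ 2
      + {w : S1 × S1 | dist (w.1 + (π : ℝ)) w.2 ≤ η}.indicator (fun _ => 4 * π ^ 2) (z, y) := by
  have hx : x = z + (a : S1) := by rw [ha.2, expc, AddCircle.coe_add, coe_logc]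
  have hy : y = z + (b : S1) := by rw [hb.2, expc, AddCircle.coe_add, coe_logc]
  have hd : dist x y = ‖((a - b : ℝ) : S1)‖ := by
    rw [dist_eq_norm, hx, hy, add_sub_add_left_eq_sub, AddCircle.coe_sub]
  have hd' : dist (z + (π : ℝ)) y = ‖((π - b : ℝ) : S1)‖ := by
    rw [dist_eq_norm, hy, add_sub_add_left_eq_sub, AddCircle.coe_sub]
  have hab : (a - b) ^ 2 ≤ 4 * π ^ 2 := by
    have := ha.1.1; have := ha.1.2; have := hb.1.1; have := hb.1.2
    nlinarith
  have hind : 0 ≤ {w : S1 × S1 | dist (w.1 + (π : ℝ)) w.2 ≤ η}.indicator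
      (fun _ => 4 * π ^ 2) (z, y) := indicator_nonneg (fun _ _ => by positivity) _
  have hc : 0 ≤ 4 * π ^ 2 / η ^ 2 * dist x y ^ 2 := by positivity
  rcases abs_sub_eq_circle_norm_or_le ha.1 hb.1 with h | h
  · have : (a - b) ^ 2 = dist x y ^ 2 := by rw [hd, ← h, sq_abs]
    linarith
  · rw [← hd, ← hd'] at h
    by_cases hn : dist (z + (π : ℝ)) y ≤ η
    · rw [indicator_of_mem (by exact hn)]
      nlinarith [sq_nonneg (dist x y)]
    · have h1 : η ^ 2 ≤ dist x y ^ 2 := by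
        gcongr; linarith
      have h2 : 4 * π ^ 2 ≤ 4 * π ^ 2 / η ^ 2 * dist x y ^ 2 := by
        rw [div_mul_eq_mul_div, le_div_iff₀ (by positivity)]
        gcongr
      nlinarith [sq_nonneg (dist x y)]

lemma tendsto_measureReal_dist_le {α X : Type*} [MeasurableSpace α] [MetricSpace X]
    [SecondCountableTopology X] [MeasurableSpace X] [BorelSpace X]
    (μ : Measure α) [IsFiniteMeasure μ] {f g : α → X}
    (hf : Measurable f) (hg : Measurable g) (h : μ {a | f a = g a} = 0) :
    Tendsto (fun k : ℕ => μ.real {a | dist (f a) (g a) ≤ 1 / ((k : ℝ) + 1)}) atTop (𝓝 0) := by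
  have hlim := tendsto_measure_iInter_atTop (μ := μ)
    (s := fun k : ℕ => {a | dist (f a) (g a) ≤ 1 / ((k : ℝ) + 1)})
    (fun k => (measurableSet_le (hf.dist hg) measurable_const).nullMeasurableSet)
    (fun k l hkl a (ha : dist (f a) (g a) ≤ _) => show dist (f a) (g a) ≤ _ from
      ha.trans (Nat.one_div_le_one_div hkl)) ⟨0, measure_ne_top _ _⟩
  have hinter : ⋂ k : ℕ, {a | dist (f a) (g a) ≤ 1 / ((k : ℝ) + 1)} = {a | f a = g a} := by
    ext a
    simp only [mem_iInter, mem_ofPred_eq]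
    refine ⟨fun ha => dist_le_zero.1 ?_, fun ha k => by rw [ha, dist_self]; positivity⟩
    exact ge_of_tendsto' tendsto_one_div_add_atTop_nhds_zero_nat ha
  rw [hinter, h] at hlim
  exact (ENNReal.tendsto_toReal ENNReal.zero_ne_top).comp hlim

/-- Let `G, G_n : S¹ → ℝ` be the displacement lifts (with values in
`[−π, π)`) of optimal transport maps `T, T_n` from `μ` to a.c. measures `ν, ν_n`. If
`∫ d_R(T_n(z), T(z))² dμ → 0`, then `∫ (G_n(z) − G(z))² dμ → 0`. -/
theorem stmt16 (μ : Measure S1) [IsProbabilityMeasure μ] (hacμ : μ ≪ volume)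
    (ν : Measure S1) [IsProbabilityMeasure ν] (hacν : ν ≪ volume)
    (νs : ℕ → Measure S1) [∀ n, IsProbabilityMeasure (νs n)]
    (hacνs : ∀ n, νs n ≪ volume)
    (T : S1 → S1) (hT : IsOTM μ ν T)
    (Tn : ℕ → S1 → S1) (hTn : ∀ n, IsOTM μ (νs n) (Tn n))
    (G : S1 → ℝ) (hG : ∀ z : S1, G z ∈ Set.Ico (-π) π ∧ T z = expc (logc z + G z))
    (Gn : ℕ → S1 → ℝ)
    (hGn : ∀ n, ∀ z : S1, Gn n z ∈ Set.Ico (-π) π ∧ Tn n z = expc (logc z + Gn n z))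
    (hconv : Tendsto (fun n => ∫ z, dist (Tn n z) (T z) ^ 2 ∂μ) atTop (𝓝 0)) :
    Tendsto (fun n => ∫ z, (Gn n z - G z) ^ 2 ∂μ) atTop (𝓝 0) := by
  have hnull : μ {z | z + ((π : ℝ) : S1) = T z} = 0 := by
    simpa only [eq_comm] using hT.measure_antipodal_eq_zero
      fun x => hacν (volume_singleton_circle x)
  have hshift : Measurable fun z : S1 => z + ((π : ℝ) : S1) := measurable_id.add_const _
  have hsmall := (tendsto_measureReal_dist_le μ hshift hT.1 hnull).mul_const (4 * π ^ 2)
  rw [zero_mul] at hsmall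
  rw [Metric.tendsto_atTop] at hsmall
  refine tendsto_order.2 ⟨fun ε hε => Eventually.of_forall fun n =>
    hε.trans_le (integral_nonneg fun z => sq_nonneg _), fun ε hε => ?_⟩
  obtain ⟨k, hk⟩ := hsmall (ε / 2) (half_pos hε)
  replace hk := lt_of_abs_lt (by simpa only [dist_zero_right, Real.norm_eq_abs] using hk k le_rfl)
  set η : ℝ := 1 / ((k : ℝ) + 1) with hη
  have hη0 : 0 < η := by positivity
  have hlim := hconv.const_mul (1 + 4 * π ^ 2 / η ^ 2)
  rw [mul_zero] at hlim
  filter_upwards [hlim.eventually_lt_const (half_pos hε)] with n hn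
  set S : Set S1 := {z | dist (z + ((π : ℝ) : S1)) (T z) ≤ η} with hS
  have hSm : MeasurableSet S := measurableSet_le (hshift.dist hT.1) measurable_const
  have hI₁ := (integrable_circle_dist_sq μ (hTn n).1 hT.1).const_mul (1 + 4 * π ^ 2 / η ^ 2)
  have hI₂ : Integrable (S.indicator fun _ => 4 * π ^ 2) μ :=
    (integrable_const _).indicator hSm
  calc ∫ z, (Gn n z - G z) ^ 2 ∂μ
      ≤ ∫ z, ((1 + 4 * π ^ 2 / η ^ 2) * dist (Tn n z) (T z) ^ 2
          + S.indicator (fun _ => 4 * π ^ 2) z) ∂μ :=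
        integral_mono_of_nonneg (Eventually.of_forall fun z => sq_nonneg _) (hI₁.add hI₂)
          (Eventually.of_forall fun z => sq_displacement_sub_le hη0 (hGn n z) (hG z))
    _ = (1 + 4 * π ^ 2 / η ^ 2) * ∫ z, dist (Tn n z) (T z) ^ 2 ∂μ
          + μ.real S * (4 * π ^ 2) := by
        rw [integral_add hI₁ hI₂, integral_const_mul, integral_indicator_const _ hSm, smul_eq_mul]
    _ < ε := by linarith

end
end
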